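/- Let F : ℝ² → ℝ² be a homeomorphism written in null coordinates as (σ, τ) = F(u,v), and suppose that for every continuous function θ : ℝ² → ℝ, the distributional mixed derivative ∂²θ/∂u∂v vanishes if and only if ∂²(θ∘F⁻¹)/∂σ∂τ vanishes (i.e., θ satisfies the wave equation in (u,v) coordinates iff it does in (σ,τ) coordinates, distributionally). Then there exist homeomorphisms φ, ψ : ℝ → ℝ such that either F(u,v) = (φ(u), ψ(v)) for all u, v, or F(u,v) = (φ(v), ψ(u)) for all u, v. -/

import Mathlib

open MeasureTheory

/-- Classical mixed partial derivative ∂²χ/∂x∂y of a test function. -/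
noncomputable def partialXY (χ : ℝ × ℝ → ℝ) (p : ℝ × ℝ) : ℝ :=
  deriv (fun y => deriv (fun x => χ (x, y)) p.1) p.2

/-- θ satisfies the wave equation in null coordinates, distributionally. -/
def SatisfiesWave (θ : ℝ × ℝ → ℝ) : Prop :=
  ∀ χ : ℝ × ℝ → ℝ, ContDiff ℝ (⊤ : ℕ∞) χ → HasCompactSupport χ →
    ∫ p, θ p * partialXY χ p = 0

lemma deriv_slice_fst {χ : ℝ × ℝ → ℝ} (hχ : Differentiable ℝ χ) (x y : ℝ) :
    deriv (fun x => χ (x, y)) x = fderiv ℝ χ (x, y) (1, 0) :=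
  ((hχ (x, y)).hasFDerivAt.comp_hasDerivAt x
    ((hasDerivAt_id x).prodMk (hasDerivAt_const x y))).deriv

lemma deriv_slice_snd {χ : ℝ × ℝ → ℝ} (hχ : Differentiable ℝ χ) (x y : ℝ) :
    deriv (fun y => χ (x, y)) y = fderiv ℝ χ (x, y) (0, 1) :=
  ((hχ (x, y)).hasFDerivAt.comp_hasDerivAt y
    ((hasDerivAt_const y x).prodMk (hasDerivAt_id y))).deriv

lemma partialXY_eq_fderiv {χ : ℝ × ℝ → ℝ} (hχ : ContDiff ℝ (⊤ : ℕ∞) χ) (p : ℝ × ℝ) :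
    partialXY χ p = fderiv ℝ (fderiv ℝ χ) p (0, 1) (1, 0) := by
  have hd : Differentiable ℝ (fderiv ℝ χ) :=
    (hχ.fderiv_right (m := 1) (by norm_cast)).differentiable (by simp)
  unfold partialXY
  simp only [deriv_slice_fst (hχ.differentiable (by simp))]
  have h1 : HasFDerivAt (fderiv ℝ χ) (fderiv ℝ (fderiv ℝ χ) p) (p.1, p.2) := (hd p).hasFDerivAt
  have h2 : HasDerivAt (fun y : ℝ => (p.1, y)) (0, 1) p.2 :=
    (hasDerivAt_const p.2 p.1).prodMk (hasDerivAt_id p.2)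
  have h3 := h1.comp_hasDerivAt p.2 h2
  exact (h3.clm_apply (hasDerivAt_const p.2 ((1 : ℝ), (0 : ℝ)))).deriv.trans (by simp)

lemma continuous_partialXY {χ : ℝ × ℝ → ℝ} (hχ : ContDiff ℝ (⊤ : ℕ∞) χ) :
    Continuous (partialXY χ) := by
  have h : Continuous (fderiv ℝ (fderiv ℝ χ)) :=
    (hχ.fderiv_right (m := 1) (by norm_cast)).continuous_fderiv (by simp)
  rw [funext (partialXY_eq_fderiv hχ)]
  fun_prop

lemma hasCompactSupport_partialXY {χ : ℝ × ℝ → ℝ} (hχ : ContDiff ℝ (⊤ : ℕ∞) χ)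
    (hc : HasCompactSupport χ) : HasCompactSupport (partialXY χ) := by
  rw [funext (partialXY_eq_fderiv hχ)]
  exact ((hc.fderiv ℝ).fderiv ℝ).comp_left
    (g := fun L : (ℝ × ℝ) →L[ℝ] (ℝ × ℝ) →L[ℝ] ℝ => L (0, 1) (1, 0)) (by simp)

lemma partialXY_swap {χ : ℝ × ℝ → ℝ} (hχ : ContDiff ℝ (⊤ : ℕ∞) χ) (p : ℝ × ℝ) :
    partialXY (fun q => χ q.swap) p = partialXY χ p.swap := by
  have hd : Differentiable ℝ (fderiv ℝ χ) :=
    (hχ.fderiv_right (m := 1) (by norm_cast)).differentiable (by simp)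
  have hsymm : IsSymmSndFDerivAt ℝ χ p.swap :=
    hχ.contDiffAt.isSymmSndFDerivAt (by simp; norm_cast)
  rw [partialXY_eq_fderiv hχ, hsymm.eq]
  unfold partialXY
  simp only [Prod.swap_prod_mk, deriv_slice_snd (hχ.differentiable (by simp))]
  have h1 : HasFDerivAt (fderiv ℝ χ) (fderiv ℝ (fderiv ℝ χ) p.swap) (p.2, p.1) :=
    (hd p.swap).hasFDerivAt
  have h2 : HasDerivAt (fun x : ℝ => (x, p.1)) (1, 0) p.2 :=
    (hasDerivAt_id p.2).prodMk (hasDerivAt_const p.2 p.1)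
  have h3 := h1.comp_hasDerivAt p.2 h2
  exact (h3.clm_apply (hasDerivAt_const p.2 ((0 : ℝ), (1 : ℝ)))).deriv.trans (by simp)

lemma satisfiesWave_comp_fst {f : ℝ → ℝ} (hf : Continuous f) :
    SatisfiesWave (fun p => f p.1) := by
  intro χ hχ hc
  have hint : Integrable (fun p : ℝ × ℝ => f p.1 * partialXY χ p) :=
    ((hf.comp continuous_fst).mul (continuous_partialXY hχ)).integrable_of_hasCompactSupport
      (hasCompactSupport_partialXY hχ hc).mul_left
  rw [Measure.volume_eq_prod] at hint ⊢
  rw [integral_prod _ hint]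
  refine integral_eq_zero_of_ae (.of_forall fun x => ?_)
  simp only [integral_const_mul, Pi.zero_apply, mul_eq_zero]
  right
  have hemb : Topology.IsClosedEmbedding (fun y : ℝ => (x, y)) :=
    .of_continuous_injective_isClosedMap (by fun_prop) (Prod.mk_right_injective x)
      (isClosedMap_prodMk_left x)
  have hx : (fun y => deriv (fun x => χ (x, y)) x) = fun y => fderiv ℝ χ (x, y) (1, 0) :=
    funext (deriv_slice_fst (hχ.differentiable (by simp)) x)
  have hC : ContDiff ℝ 1 (fun y => deriv (fun x => χ (x, y)) x) := by
    rw [hx]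
    have := hχ.fderiv_right (m := 1) (by norm_cast)
    fun_prop
  have hS : HasCompactSupport (fun y => deriv (fun x => χ (x, y)) x) := by
    rw [hx]
    exact ((hc.fderiv ℝ).comp_isClosedEmbedding hemb).comp_left
      (g := fun L : (ℝ × ℝ) →L[ℝ] ℝ => L (1, 0)) (by simp)
  exact integral_eq_zero_of_hasDerivAt_of_integrable
    (fun y => (hC.differentiable (by simp) y).hasDerivAt)
    ((hC.continuous_deriv (by simp)).integrable_of_hasCompactSupport hS.deriv)
    (hC.continuous.integrable_of_hasCompactSupport hS)

lemma satisfiesWave_comp_snd {f : ℝ → ℝ} (hf : Continuous f) :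
    SatisfiesWave (fun p => f p.2) := by
  intro χ hχ hc
  have h := satisfiesWave_comp_fst hf (fun q => χ q.swap) (hχ.comp (contDiff_snd.prodMk contDiff_fst))
    (hc.comp_homeomorph (Homeomorph.prodComm ℝ ℝ))
  simp only [partialXY_swap hχ] at h
  rw [Measure.volume_eq_prod] at h ⊢
  rw [← h, ← integral_prod_swap]
  rfl

/-- A difference of two translates of a bump function is the derivative of a test function. -/
lemma exists_deriv_eq_translate_sub {η : ℝ → ℝ} (hη : ContDiff ℝ (⊤ : ℕ∞) η)
    (hc : HasCompactSupport η) (a a' : ℝ) :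
    ∃ A : ℝ → ℝ, ContDiff ℝ (⊤ : ℕ∞) A ∧ HasCompactSupport A ∧
      ∀ x, deriv A x = η (x - a) - η (x - a') := by
  have hd : ∀ x, HasDerivAt (fun x => ∫ t in (x - a')..(x - a), η t)
      (η (x - a) - η (x - a')) x := by
    intro x
    have hI : ∀ c d : ℝ, IntervalIntegrable η volume c d :=
      fun c d => hη.continuous.intervalIntegrable c d
    have hH : ∀ y, HasDerivAt (fun y => ∫ t in (0 : ℝ)..y, η t) (η y) y :=
      fun y => (hη.continuous.integral_hasStrictDerivAt 0 y).hasDerivAt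
    have h := ((hH (x - a)).comp_sub_const x a).sub ((hH (x - a')).comp_sub_const x a')
    refine h.congr_of_eventuallyEq (.of_forall fun y => ?_)
    exact (intervalIntegral.integral_interval_sub_left (hI _ _) (hI _ _)).symm
  have hderiv := fun x => (hd x).deriv
  refine ⟨_, ?_, ?_, hderiv⟩
  · rw [contDiff_infty_iff_deriv]
    refine ⟨fun x => (hd x).differentiableAt, ?_⟩
    rw [funext hderiv]
    fun_prop
  · obtain ⟨R, hR⟩ := hc.isCompact.isBounded.subset_closedBall 0
    have hzero : ∀ t, R < |t| → η t = 0 := by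
      intro t ht
      by_contra hne
      have := hR (subset_tsupport η hne)
      simp only [Metric.mem_closedBall, dist_zero_right, Real.norm_eq_abs] at this
      linarith
    refine HasCompactSupport.intro (isCompact_closedBall (0 : ℝ) (|R| + |a| + |a'|)) ?_
    intro x hx
    simp only [Metric.mem_closedBall, dist_zero_right, Real.norm_eq_abs, not_le] at hx
    have : ∀ t ∈ Set.uIcc (x - a') (x - a), η t = 0 := by
      intro t ht
      apply hzero
      rw [Set.mem_uIcc] at ht
      have := le_abs_self R
      have := le_abs_self a
      have := neg_abs_le a
      have := le_abs_self a'
      have := neg_abs_le a'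
      have := abs_nonneg R
      rw [lt_abs] at hx ⊢
      rcases hx with hx | hx
      · left; rcases ht with ⟨h1, h2⟩ | ⟨h1, h2⟩ <;> linarith
      · right; rcases ht with ⟨h1, h2⟩ | ⟨h1, h2⟩ <;> linarith
    rw [intervalIntegral.integral_congr (g := fun _ => 0) this]
    simp

lemma HasCompactSupport.mul_prod {A B : ℝ → ℝ} (hA : HasCompactSupport A)
    (hB : HasCompactSupport B) : HasCompactSupport (fun q : ℝ × ℝ => A q.1 * B q.2) := by
  refine HasCompactSupport.intro (hA.isCompact.prod hB.isCompact) fun q hq => ?_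
  rw [Set.mem_prod, not_and_or] at hq
  rcases hq with hq | hq
  · simp [image_eq_zero_of_notMem_tsupport hq]
  · simp [image_eq_zero_of_notMem_tsupport hq]

lemma partialXY_mul (A B : ℝ → ℝ) (p : ℝ × ℝ) :
    partialXY (fun q => A q.1 * B q.2) p = deriv A p.1 * deriv B p.2 := by
  simp [partialXY]

lemma integral_sub_sub_add {α : Type*} [MeasurableSpace α] {μ : Measure α} {f g h k : α → ℝ}
    (hf : Integrable f μ) (hg : Integrable g μ) (hh : Integrable h μ) (hk : Integrable k μ) :
    ∫ x, f x - g x - h x + k x ∂μ = ∫ x, f x ∂μ - ∫ x, g x ∂μ - ∫ x, h x ∂μ + ∫ x, k x ∂μ := by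
  have h1 : Integrable (fun x => f x - g x) μ := hf.sub hg
  have h2 : Integrable (fun x => f x - g x - h x) μ := h1.sub hh
  rw [integral_add h2 hk, integral_sub h1 hh, integral_sub hf hg]

lemma SatisfiesWave.rectangle_le {θ : ℝ × ℝ → ℝ} (hθ : Continuous θ) (h : SatisfiesWave θ)
    (a a' b b' : ℝ) : θ (a, b) + θ (a', b') ≤ θ (a', b) + θ (a, b') := by
  by_contra! hlt
  let D : ℝ × ℝ → ℝ := fun p => θ (p + (a, b)) - θ (p + (a', b)) - θ (p + (a, b'))
    + θ (p + (a', b'))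
  have hDc : Continuous D := by fun_prop
  have hD0 : 0 < D (0, 0) := by
    simp only [D, Prod.mk_add_mk, zero_add]
    linarith
  obtain ⟨ε, hε, hball⟩ := Metric.isOpen_iff.1 (isOpen_lt continuous_const hDc) (0, 0) hD0
  let η : ContDiffBump (0 : ℝ) := ⟨ε / 2, ε, by positivity, by linarith⟩
  have hηs : ContDiff ℝ (⊤ : ℕ∞) η := η.contDiff
  have hηc := η.hasCompactSupport
  obtain ⟨A, hA, hAc, hA'⟩ := exists_deriv_eq_translate_sub hηs hηc a a'
  obtain ⟨B, hB, hBc, hB'⟩ := exists_deriv_eq_translate_sub hηs hηc b b'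
  have hwave := h (fun q => A q.1 * B q.2) (by fun_prop) (hAc.mul_prod hBc)
  have hKc : HasCompactSupport (fun p : ℝ × ℝ => η p.1 * η p.2) := hηc.mul_prod hηc
  have hηcont : Continuous η := η.continuous
  have hI : ∀ w : ℝ × ℝ, Integrable (fun p => θ (p + w) * (η p.1 * η p.2)) := fun w =>
    Continuous.integrable_of_hasCompactSupport (by fun_prop) hKc.mul_left
  have hshift : ∀ w p : ℝ × ℝ, θ (p - w + w) * (η (p - w).1 * η (p - w).2)
      = θ p * (η (p.1 - w.1) * η (p.2 - w.2)) := by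
    intro w p
    simp
  have hI' : ∀ w : ℝ × ℝ, Integrable (fun p => θ p * (η (p.1 - w.1) * η (p.2 - w.2))) := by
    intro w
    have := (hI w).comp_sub_right w
    simpa only [hshift] using this
  have hE : ∀ w : ℝ × ℝ, ∫ p, θ p * (η (p.1 - w.1) * η (p.2 - w.2))
      = ∫ p, θ (p + w) * (η p.1 * η p.2) := by
    intro w
    rw [← integral_sub_right_eq_self (fun p => θ (p + w) * (η p.1 * η p.2)) w]
    simp only [hshift]
  have hzero : ∫ p, D p * (η p.1 * η p.2) = 0 := by
    have e1 : (fun p => D p * (η p.1 * η p.2)) = fun p =>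
        θ (p + (a, b)) * (η p.1 * η p.2) - θ (p + (a', b)) * (η p.1 * η p.2)
        - θ (p + (a, b')) * (η p.1 * η p.2) + θ (p + (a', b')) * (η p.1 * η p.2) := by
      funext p; simp only [D]; ring
    have e2 : (fun p => θ p * partialXY (fun q => A q.1 * B q.2) p) = fun p =>
        θ p * (η (p.1 - (a, b).1) * η (p.2 - (a, b).2))
        - θ p * (η (p.1 - (a', b).1) * η (p.2 - (a', b).2))
        - θ p * (η (p.1 - (a, b').1) * η (p.2 - (a, b').2))
        + θ p * (η (p.1 - (a', b').1) * η (p.2 - (a', b').2)) := by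
      funext p; rw [partialXY_mul, hA', hB']; ring
    rw [e2, integral_sub_sub_add (hI' _) (hI' _) (hI' _) (hI' _), hE, hE, hE, hE] at hwave
    rw [e1, integral_sub_sub_add (hI _) (hI _) (hI _) (hI _)]
    exact hwave
  have hpos : 0 < ∫ p, D p * (η p.1 * η p.2) := by
    refine Continuous.integral_pos_of_hasCompactSupport_nonneg_nonzero (x := (0, 0))
      (by fun_prop) hKc.mul_left (fun p => ?_) ?_
    · by_cases hp : p ∈ Metric.ball ((0, 0) : ℝ × ℝ) ε
      · exact mul_nonneg (le_of_lt (hball hp)) (mul_nonneg η.nonneg η.nonneg)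
      · have : η p.1 * η p.2 = 0 := by
          rw [← ball_prod_same, Set.mem_prod, not_and_or] at hp
          rcases hp with hp | hp
          · rw [η.zero_of_le_dist (x := p.1) (by simpa using hp), zero_mul]
          · rw [η.zero_of_le_dist (x := p.2) (by simpa using hp), mul_zero]
        simp [this]
    · have h1 : η 0 = 1 := η.one_of_mem_closedBall (by simp [η.rIn_pos.le])
      simpa [h1] using hD0.ne'
  exact hpos.ne' hzero

lemma SatisfiesWave.rectangle_eq {θ : ℝ × ℝ → ℝ} (hθ : Continuous θ) (h : SatisfiesWave θ)
    (a a' b b' : ℝ) : θ (a, b) + θ (a', b') = θ (a', b) + θ (a, b') :=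
  le_antisymm (h.rectangle_le hθ a a' b b') (h.rectangle_le hθ a' a b b')

/-- If a continuous function and its square both satisfy the wave equation, the function depends
on only one of the null coordinates. -/
lemma SatisfiesWave.eq_fst_or_eq_snd {θ : ℝ × ℝ → ℝ} (hθ : Continuous θ) (h : SatisfiesWave θ)
    (h2 : SatisfiesWave (fun p => θ p ^ 2)) :
    (∀ a b b', θ (a, b) = θ (a, b')) ∨ (∀ a a' b, θ (a, b) = θ (a', b)) := by
  have key : ∀ a a' b b', (θ (a, b) - θ (a', b)) * (θ (a, b) - θ (a, b')) = 0 := by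
    intro a a' b b'
    have e1 := h.rectangle_eq hθ a a' b b'
    have e2 := h2.rectangle_eq (hθ.pow 2) a a' b b'
    have e3 : θ (a', b') = θ (a', b) + θ (a, b') - θ (a, b) := by linarith
    simp only [Pi.pow_apply] at e2
    rw [e3] at e2
    linarith
  rw [or_iff_not_imp_right]
  intro hne
  push Not at hne
  obtain ⟨a, a', b, hne⟩ := hne
  have hconst : ∀ b', θ (a, b') = θ (a, b) := fun b' => by
    have := (mul_eq_zero.1 (key a a' b b')).resolve_left (sub_ne_zero.2 hne)
    linarith
  intro c d d'
  have := h.rectangle_eq hθ a c d d'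
  rw [hconst d, hconst d'] at this
  linarith

/-- A homeomorphism of a product whose components each depend on the corresponding coordinate
is a product of homeomorphisms. -/
lemma Homeomorph.exists_eq_prod {X Y : Type*} [TopologicalSpace X] [TopologicalSpace Y]
    [Nonempty X] [Nonempty Y] (G : (X × Y) ≃ₜ (X × Y))
    (h1 : ∀ a b b', (G (a, b)).1 = (G (a, b')).1) (h2 : ∀ a a' b, (G (a, b)).2 = (G (a', b)).2) :
    ∃ (φ : X ≃ₜ X) (ψ : Y ≃ₜ Y), ∀ u v, G (u, v) = (φ u, ψ v) := by
  obtain ⟨x₀⟩ := ‹Nonempty X›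
  obtain ⟨y₀⟩ := ‹Nonempty Y›
  refine ⟨⟨⟨fun u => (G (u, y₀)).1, fun s => (G.symm (s, (G (x₀, y₀)).2)).1, ?_, ?_⟩,
      by fun_prop, by fun_prop⟩,
    ⟨⟨fun v => (G (x₀, v)).2, fun t => (G.symm ((G (x₀, y₀)).1, t)).2, ?_, ?_⟩,
      by fun_prop, by fun_prop⟩, fun u v => Prod.ext (h1 u v y₀) (h2 u x₀ v)⟩
  · intro u
    simp only [h2 x₀ u y₀, Prod.mk.eta, G.symm_apply_apply]
  · intro s
    simp only [h1 _ y₀ (G.symm (s, (G (x₀, y₀)).2)).2, Prod.mk.eta, G.apply_symm_apply]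
  · intro v
    simp only [h1 x₀ y₀ v, Prod.mk.eta, G.symm_apply_apply]
  · intro t
    simp only [h2 x₀ (G.symm ((G (x₀, y₀)).1, t)).1, Prod.mk.eta, G.apply_symm_apply]

theorem stmt_15 (F : (ℝ × ℝ) ≃ₜ (ℝ × ℝ))
    (hwave : ∀ θ : ℝ × ℝ → ℝ, Continuous θ →
      (SatisfiesWave θ ↔ SatisfiesWave (θ ∘ F.symm))) :
    ∃ φ ψ : ℝ ≃ₜ ℝ,
      (∀ u v : ℝ, F (u, v) = (φ u, ψ v)) ∨
      (∀ u v : ℝ, F (u, v) = (φ v, ψ u)) := by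
  have pull : ∀ θ : ℝ × ℝ → ℝ, Continuous θ → SatisfiesWave θ →
      SatisfiesWave (fun p => θ (F p)) := by
    intro θ hc hθ
    refine (hwave _ (hc.comp F.continuous)).2 ?_
    convert hθ using 1
    funext p
    simp
  have hfst := (pull _ continuous_fst (satisfiesWave_comp_fst continuous_id)).eq_fst_or_eq_snd
    (continuous_fst.comp F.continuous)
    (pull _ (continuous_fst.pow 2) (satisfiesWave_comp_fst (continuous_pow 2)))
  have hsnd := (pull _ continuous_snd (satisfiesWave_comp_snd continuous_id)).eq_fst_or_eq_snd
    (continuous_snd.comp F.continuous)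
    (pull _ (continuous_snd.pow 2) (satisfiesWave_comp_snd (continuous_pow 2)))
  rcases hfst with h1 | h1 <;> rcases hsnd with h2 | h2
  · have := F.injective (Prod.ext (h1 0 0 1) (h2 0 0 1))
    simp at this
  · obtain ⟨φ, ψ, h⟩ := F.exists_eq_prod h1 h2
    exact ⟨φ, ψ, .inl h⟩
  · obtain ⟨φ, ψ, h⟩ := ((Homeomorph.prodComm ℝ ℝ).trans F).exists_eq_prod
      (fun a b b' => h1 b b' a) (fun a a' b => h2 b a a')
    exact ⟨φ, ψ, .inr fun u v => h v u⟩
  · have := F.injective (Prod.ext (h1 0 1 0) (h2 0 1 0))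
    simp at this
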